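/- arXiv:1904.12003 — 4 statements merged into one kernel-verified Lean document; each statement's English description precedes it below -/
import Mathlib

section
/- Let n ≥ 1 and let L : ℂ → Mₙ(ℂ) be a map whose matrix entries are polynomial functions of the complex variable t, and assume L(t) is Hermitian for every t ∈ ℝ. Then there exist continuous maps v₁, …, vₙ : ℝ → ℂⁿ and continuous functions η₁, …, ηₙ : ℝ → ℝ such that: (1) for each t ∈ ℝ the vectors v₁(t), …, vₙ(t) form a ℂ-linear basis of ℂⁿ that is pairwise orthogonal with respect to the standard Hermitian inner product on ℂⁿ; and (2) L(t)·vᵢ(t) = ηᵢ(t)·vᵢ(t) for every i and every t ∈ ℝ. -/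
section

open scoped Matrix.Norms.Operator Topology
open Filter

namespace Matrix

variable {ι : Type*} [Fintype ι] [DecidableEq ι]

/-- Entrywise multiplication by a fixed real matrix, as a continuous real-linear map. -/
noncomputable def schurMulCLM (c : ι → ι → ℝ) : Matrix ι ι ℂ →L[ℝ] Matrix ι ι ℂ :=
  LinearMap.toContinuousLinearMap
    { toFun := fun X => of fun i j => (c i j : ℂ) * X i j
      map_add' := fun X Y => by ext i j; simp [mul_add]
      map_smul' := fun r X => by ext i j; simp [mul_left_comm] }

omit [DecidableEq ι] in
@[simp]
theorem schurMulCLM_apply (c : ι → ι → ℝ) (X : Matrix ι ι ℂ) (i j : ι) :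
    schurMulCLM c X i j = (c i j : ℂ) * X i j := rfl

omit [DecidableEq ι] in
theorem conjTranspose_schurMulCLM (c : ι → ι → ℝ) (X : Matrix ι ι ℂ) :
    (schurMulCLM c X)ᴴ = schurMulCLM (fun i j => c j i) Xᴴ := by
  ext i j
  simp [conjTranspose_apply]

theorem schurMulCLM_diagonal (c : ι → ι → ℝ) (d : ι → ℂ) :
    schurMulCLM c (diagonal d) = diagonal fun i => (c i i : ℂ) * d i := by
  ext i j
  by_cases h : i = j
  · subst h; simp
  · simp [h]

/-- Conjugation of the `b`-part of a matrix by the exponential of its `k`-part. -/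
noncomputable def expConj (k b : ι → ι → ℝ) (X : Matrix ι ι ℂ) : Matrix ι ι ℂ :=
  NormedSpace.exp (schurMulCLM k X) * schurMulCLM b X * NormedSpace.exp (-schurMulCLM k X)

theorem analyticAt_expConj (k b : ι → ι → ℝ) (X : Matrix ι ι ℂ) :
    AnalyticAt ℝ (expConj k b) X := by
  have hk := (schurMulCLM (ι := ι) k).analyticAt X
  have hexp : ∀ Y : Matrix ι ι ℂ, AnalyticAt ℝ NormedSpace.exp Y :=
    fun Y => NormedSpace.exp_analytic (𝕂 := ℝ) Y
  have h1 : AnalyticAt ℝ (fun X => NormedSpace.exp (schurMulCLM k X)) X :=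
    (hexp _).fun_comp hk
  have h2 : AnalyticAt ℝ (fun X => NormedSpace.exp (-schurMulCLM k X)) X :=
    (hexp _).fun_comp hk.neg
  exact (h1.mul ((schurMulCLM (ι := ι) b).analyticAt X)).mul h2

theorem conjTranspose_expConj {k b : ι → ι → ℝ} (hk : ∀ i j, k j i = -k i j)
    (hb : ∀ i j, b j i = b i j) (X : Matrix ι ι ℂ) :
    (expConj k b X)ᴴ = expConj k b Xᴴ := by
  have h1 : (schurMulCLM k X)ᴴ = -schurMulCLM k Xᴴ := by
    ext i j
    simp [hk i j]
  have h2 : (schurMulCLM b X)ᴴ = schurMulCLM b Xᴴ := by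
    simp_rw [conjTranspose_schurMulCLM, hb]
  simp only [expConj, conjTranspose_mul, ← exp_conjTranspose, conjTranspose_neg, h1, h2, neg_neg,
    mul_assoc]

theorem hasStrictFDerivAt_expConj {k b : ι → ι → ℝ} (hk : ∀ i, k i i = 0)
    (hb : ∀ i, b i i = 1) (d : ι → ℝ) :
    HasStrictFDerivAt (expConj k b) (schurMulCLM fun i j => b i j + k i j * (d j - d i))
      (diagonal fun i => (d i : ℂ)) := by
  set C : Matrix ι ι ℂ := diagonal fun i => (d i : ℂ) with hC
  have hkC : schurMulCLM k C = 0 := by simp [hC, schurMulCLM_diagonal, hk]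
  have hbC : schurMulCLM b C = C := by simp [hC, schurMulCLM_diagonal, hb]
  have hexp : HasStrictFDerivAt (NormedSpace.exp : Matrix ι ι ℂ → Matrix ι ι ℂ)
      (1 : Matrix ι ι ℂ →L[ℝ] Matrix ι ι ℂ) 0 := hasStrictFDerivAt_exp_zero
  have h1 : HasStrictFDerivAt (fun X => NormedSpace.exp (schurMulCLM k X))
      ((1 : Matrix ι ι ℂ →L[ℝ] Matrix ι ι ℂ).comp (schurMulCLM k)) C :=
    HasStrictFDerivAt.comp (g := NormedSpace.exp) C (by rw [hkC]; exact hexp)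
      (schurMulCLM (ι := ι) k).hasStrictFDerivAt
  have h2 : HasStrictFDerivAt (fun X => NormedSpace.exp (-schurMulCLM k X))
      ((1 : Matrix ι ι ℂ →L[ℝ] Matrix ι ι ℂ).comp (-schurMulCLM k)) C :=
    HasStrictFDerivAt.comp (g := NormedSpace.exp) C (by rw [hkC, neg_zero]; exact hexp)
      (schurMulCLM (ι := ι) k).hasStrictFDerivAt.neg
  have h := (h1.mul' ((schurMulCLM (ι := ι) b).hasStrictFDerivAt (x := C))).mul' h2
  refine HasStrictFDerivAt.congr_fderiv h ?_
  refine ContinuousLinearMap.ext fun H => ?_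
  change NormedSpace.exp (schurMulCLM k C) * schurMulCLM b C * -schurMulCLM k H +
    (NormedSpace.exp (schurMulCLM k C) * schurMulCLM b H + schurMulCLM k H * schurMulCLM b C) *
      NormedSpace.exp (-schurMulCLM k C) = _
  rw [hkC, hbC, neg_zero, NormedSpace.exp_zero, one_mul, one_mul, mul_one]
  ext i j
  change _ = ((b i j + k i j * (d j - d i) : ℝ) : ℂ) * H i j
  simp [hC]
  ring

/-- A real-analytic Hermitian family that is diagonal at `t₀` is, near `t₀`, analytically and
unitarily equivalent to a family that is block diagonal with respect to any partition of the
indices into two classes having no eigenvalue in common at `t₀`. -/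
theorem exists_analyticAt_blockDiagonalization {A : ℝ → Matrix ι ι ℂ} {t₀ : ℝ}
    (hA : AnalyticAt ℝ A t₀) (hherm : ∀ᶠ t in 𝓝 t₀, (A t).IsHermitian) (d : ι → ℝ)
    (hd : A t₀ = diagonal fun i => (d i : ℂ)) (p : ι → Prop)
    (hp : ∀ i j, p i → ¬ p j → d i ≠ d j) :
    ∃ W X : ℝ → Matrix ι ι ℂ, AnalyticAt ℝ W t₀ ∧ AnalyticAt ℝ X t₀ ∧
      ∀ᶠ t in 𝓝 t₀, (W t)ᴴ * W t = 1 ∧ A t * W t = W t * X t ∧ (X t).IsHermitian ∧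
        ∀ i j, ¬(p i ↔ p j) → X t i j = 0 := by
  classical
  let e : ι → ℝ := fun i => if p i then 1 else 0
  let k : ι → ι → ℝ := fun i j => e i - e j
  let b : ι → ι → ℝ := fun i j => if (p i ↔ p j) then 1 else 0
  let c : ι → ι → ℝ := fun i j => b i j + k i j * (d j - d i)
  have hc : ∀ i j, c i j ≠ 0 := by
    intro i j
    by_cases hi : p i <;> by_cases hj : p j <;> simp [c, b, k, e, hi, hj, sub_eq_zero]
    · exact (hp i j hi hj).symm
    · exact (hp j i hj hi).symm
  have hkk : ∀ i j, k j i = -k i j := fun i j => by simp [k]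
  have hbb : ∀ i j, b j i = b i j := fun i j => by simp [b, iff_comm]
  set C : Matrix ι ι ℂ := diagonal fun i => (d i : ℂ) with hC
  have hderiv : HasStrictFDerivAt (expConj k b) (schurMulCLM c) C :=
    hasStrictFDerivAt_expConj (fun i => by simp [k]) (fun i => by simp [b]) d
  have hΦC : expConj k b C = C := by
    simp [expConj, hC, schurMulCLM_diagonal, k, b]
  have hinj : Function.Injective (schurMulCLM c) := by
    intro X Y h
    ext i j
    have := congrFun (congrFun h i) j
    simpa [hc i j] using this
  let f' : Matrix ι ι ℂ ≃L[ℝ] Matrix ι ι ℂ :=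
    (LinearEquiv.ofInjectiveEndo (schurMulCLM c : Matrix ι ι ℂ →ₗ[ℝ] Matrix ι ι ℂ)
      hinj).toContinuousLinearEquiv
  have hf' : HasStrictFDerivAt (expConj k b) (f' : Matrix ι ι ℂ →L[ℝ] Matrix ι ι ℂ) C :=
    hderiv.congr_fderiv (by ext; rfl)
  have hcd : ContDiffAt ℝ ⊤ (expConj k b) C := (analyticAt_expConj k b C).contDiffAt
  let Ψ := hf'.localInverse
  have hΨC : Ψ C = C := by
    have := hf'.localInverse_apply_image
    rwa [hΦC] at this
  have hΨ : AnalyticAt ℝ Ψ C := by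
    have := hcd.to_localInverse hf'.hasFDerivAt (by simp)
    rw [hΦC] at this
    exact this.analyticAt
  have hright : ∀ᶠ Y in 𝓝 C, expConj k b (Ψ Y) = Y := by
    have := hf'.eventually_right_inverse
    rwa [hΦC] at this
  have hleft : ∀ᶠ X in 𝓝 C, Ψ (expConj k b X) = X := hf'.eventually_left_inverse
  have hAt : Tendsto A (𝓝 t₀) (𝓝 C) := by
    have := hA.continuousAt.tendsto
    rwa [hd] at this
  have hΨA : AnalyticAt ℝ (fun t => Ψ (A t)) t₀ := hΨ.fun_comp_of_eq hA hd
  have hΨt : Tendsto (fun t => (Ψ (A t))ᴴ) (𝓝 t₀) (𝓝 C) := by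
    have h1 : Tendsto (fun t => Ψ (A t)) (𝓝 t₀) (𝓝 C) := by
      have := hΨA.continuousAt.tendsto
      rwa [hd, hΨC] at this
    have h2 := (continuous_id.matrix_conjTranspose.tendsto C).comp h1
    simpa [hC, diagonal_conjTranspose, Function.comp_def, Pi.star_def] using h2
  have hexp : ∀ Y : Matrix ι ι ℂ, AnalyticAt ℝ NormedSpace.exp Y :=
    fun Y => NormedSpace.exp_analytic (𝕂 := ℝ) Y
  refine ⟨fun t => NormedSpace.exp (schurMulCLM k (Ψ (A t))), fun t => schurMulCLM b (Ψ (A t)),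
    (hexp _).fun_comp ((schurMulCLM (ι := ι) k).analyticAt _ |>.fun_comp hΨA),
    (schurMulCLM (ι := ι) b).analyticAt _ |>.fun_comp hΨA, ?_⟩
  filter_upwards [hherm, hAt.eventually hright, hΨt.eventually hleft] with t ht h1 h2
  have hX : (Ψ (A t))ᴴ = Ψ (A t) := by
    rw [← h2, ← conjTranspose_expConj hkk hbb, h1, ht.eq]
  set X := Ψ (A t)
  have hK : (schurMulCLM k X)ᴴ = -schurMulCLM k X := by
    ext i j
    rw [conjTranspose_schurMulCLM, hX]
    simp [hkk i j]
  have hinv : NormedSpace.exp (-schurMulCLM k X) * NormedSpace.exp (schurMulCLM k X) = 1 := by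
    rw [← exp_add_of_commute _ _ (Commute.refl (schurMulCLM k X)).neg_left]
    simp
  refine ⟨?_, ?_, ?_, ?_⟩
  · rw [← exp_conjTranspose, hK, hinv]
  · conv_lhs => rw [← h1]
    rw [expConj, mul_assoc, hinv, mul_one]
  · rw [IsHermitian, conjTranspose_schurMulCLM, hX]
    simp_rw [hbb]
  · intro i j hij
    simp [b, hij]

omit [DecidableEq ι] in
theorem analyticAt_iff_entries {A : ℝ → Matrix ι ι ℂ} {t₀ : ℝ} :
    AnalyticAt ℝ A t₀ ↔ ∀ i j, AnalyticAt ℝ (fun t => A t i j) t₀ := by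
  let e : (ι → ι → ℂ) ≃L[ℝ] Matrix ι ι ℂ := (ofLinearEquiv ℝ).toContinuousLinearEquiv
  constructor
  · intro h i j
    have h1 : AnalyticAt ℝ (fun t => e.symm (A t)) t₀ := (e.symm.analyticAt _).fun_comp h
    rw [analyticAt_pi_iff] at h1
    have h2 := h1 i
    rw [analyticAt_pi_iff] at h2
    exact h2 j
  · intro h
    have h1 : AnalyticAt ℝ (fun t i j => A t i j) t₀ :=
      analyticAt_pi_iff.2 fun i => analyticAt_pi_iff.2 fun j => h i j
    exact (e.analyticAt _).fun_comp h1

/-- Real-analytic unitary diagonalizability of a family of matrices near a point. -/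
def AnalyticDiagAt (A : ℝ → Matrix ι ι ℂ) (t₀ : ℝ) : Prop :=
  ∃ (U : ℝ → Matrix ι ι ℂ) (D : ℝ → ι → ℝ), AnalyticAt ℝ U t₀ ∧
    (∀ i, AnalyticAt ℝ (fun t => D t i) t₀) ∧
    ∀ᶠ t in 𝓝 t₀, (U t)ᴴ * U t = 1 ∧ A t * U t = U t * diagonal fun i => (D t i : ℂ)

namespace AnalyticDiagAt

variable {A B X : ℝ → Matrix ι ι ℂ} {t₀ : ℝ}

theorem zero : AnalyticDiagAt (0 : ℝ → Matrix ι ι ℂ) t₀ :=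
  ⟨fun _ => 1, fun _ _ => 0, analyticAt_const, fun _ => analyticAt_const, by simp⟩

theorem of_conj {W : ℝ → Matrix ι ι ℂ} (hX : AnalyticDiagAt X t₀) (hW : AnalyticAt ℝ W t₀)
    (h : ∀ᶠ t in 𝓝 t₀, (W t)ᴴ * W t = 1 ∧ A t * W t = W t * X t) : AnalyticDiagAt A t₀ := by
  obtain ⟨U, D, hU, hD, hUD⟩ := hX
  refine ⟨fun t => W t * U t, D, hW.mul hU, hD, ?_⟩
  filter_upwards [h, hUD] with t ⟨h1, h2⟩ ⟨h3, h4⟩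
  constructor
  · rw [conjTranspose_mul, mul_assoc, ← mul_assoc (W t)ᴴ, h1, one_mul, h3]
  · rw [← mul_assoc, h2, mul_assoc, h4, mul_assoc]

theorem smul_one_add_smul {a b : ℝ → ℝ} (hB : AnalyticDiagAt B t₀) (ha : AnalyticAt ℝ a t₀)
    (hb : AnalyticAt ℝ b t₀)
    (h : ∀ᶠ t in 𝓝 t₀, A t = (a t : ℂ) • (1 : Matrix ι ι ℂ) + (b t : ℂ) • B t) :
    AnalyticDiagAt A t₀ := by
  obtain ⟨U, D, hU, hD, hUD⟩ := hB
  refine ⟨U, fun t i => a t + b t * D t i, hU, fun i => ha.add (hb.mul (hD i)), ?_⟩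
  filter_upwards [h, hUD] with t h1 ⟨h3, h4⟩
  refine ⟨h3, ?_⟩
  have : (diagonal fun i => ((a t + b t * D t i : ℝ) : ℂ)) =
      (a t : ℂ) • (1 : Matrix ι ι ℂ) + (b t : ℂ) • diagonal fun i => (D t i : ℂ) := by
    ext i j
    by_cases hij : i = j
    · subst hij; simp
    · simp [hij]
  rw [h1, this, add_mul, mul_add, smul_mul_assoc, smul_mul_assoc, h4]
  simp

theorem of_blocks (p : ι → Prop) [DecidablePred p]
    (h : ∀ᶠ t in 𝓝 t₀, ∀ i j, ¬(p i ↔ p j) → X t i j = 0)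
    (h₁ : AnalyticDiagAt (fun t => (X t).toBlock p p) t₀)
    (h₂ : AnalyticDiagAt (fun t => (X t).toBlock (fun i => ¬p i) fun i => ¬p i) t₀) :
    AnalyticDiagAt X t₀ := by
  obtain ⟨U₁, D₁, hU₁, hD₁, hUD₁⟩ := h₁
  obtain ⟨U₂, D₂, hU₂, hD₂, hUD₂⟩ := h₂
  let e := (Equiv.sumCompl p).symm
  rw [analyticAt_iff_entries] at hU₁ hU₂
  refine ⟨fun t => (fromBlocks (U₁ t) 0 0 (U₂ t)).submatrix e e,
    fun t i => Sum.elim (D₁ t) (D₂ t) (e i), ?_, ?_, ?_⟩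
  · rw [analyticAt_iff_entries]
    intro i j
    simp only [submatrix_apply]
    rcases e i with i | i <;> rcases e j with j | j
    · exact hU₁ i j
    · exact analyticAt_const
    · exact analyticAt_const
    · exact hU₂ i j
  · intro i
    rcases hi : e i with i' | i'
    · simpa only [hi] using! hD₁ i'
    · simpa only [hi] using! hD₂ i'
  · filter_upwards [h, hUD₁, hUD₂] with t ht ⟨h1, h2⟩ ⟨h3, h4⟩
    have hX : X t = (fromBlocks ((X t).toBlock p p) 0 0
        ((X t).toBlock (fun i => ¬p i) fun i => ¬p i)).submatrix e e := by
      ext i j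
      by_cases hi : p i <;> by_cases hj : p j
      · simp [e, Equiv.sumCompl_symm_apply_of_pos hi, Equiv.sumCompl_symm_apply_of_pos hj]
      · simp [e, Equiv.sumCompl_symm_apply_of_pos hi, Equiv.sumCompl_symm_apply_of_neg hj,
          ht i j (by tauto)]
      · simp [e, Equiv.sumCompl_symm_apply_of_neg hi, Equiv.sumCompl_symm_apply_of_pos hj,
          ht i j (by tauto)]
      · simp [e, Equiv.sumCompl_symm_apply_of_neg hi, Equiv.sumCompl_symm_apply_of_neg hj]
    have hD : (diagonal fun i => ((Sum.elim (D₁ t) (D₂ t) (e i) : ℝ) : ℂ)) =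
        (fromBlocks (diagonal fun i => (D₁ t i : ℂ)) 0 0
          (diagonal fun i => (D₂ t i : ℂ))).submatrix e e := by
      rw [fromBlocks_diagonal, submatrix_diagonal_equiv]
      congr 1
      ext i
      rcases hi : e i with i' | i' <;> simp [hi]
    constructor
    · rw [conjTranspose_submatrix, submatrix_mul_equiv, fromBlocks_conjTranspose,
        fromBlocks_multiply]
      simp [h1, h3]
    · conv_lhs => rw [hX]
      rw [hD, submatrix_mul_equiv, submatrix_mul_equiv, fromBlocks_multiply, fromBlocks_multiply]
      simp [h2, h4]

end AnalyticDiagAt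

/-- A Hermitian matrix of trace zero having only one eigenvalue vanishes. -/
theorem IsHermitian.exists_eigenvalues_ne {M : Matrix ι ι ℂ} (hM : M.IsHermitian)
    (htr : M.trace = 0) (hne : M ≠ 0) : ∃ i j, hM.eigenvalues i ≠ hM.eigenvalues j := by
  by_contra! hall
  apply hne
  rw [← hM.eigenvalues_eq_zero_iff]
  have hsum : ∑ i, hM.eigenvalues i = 0 := by
    have := hM.trace_eq_sum_eigenvalues
    rw [htr, ← RCLike.ofReal_sum] at this
    exact RCLike.ofReal_eq_zero.1 this.symm
  ext i
  have h2 : ∑ j, hM.eigenvalues j = Fintype.card ι * hM.eigenvalues i := by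
    rw [Finset.sum_congr rfl fun j _ => hall j i]
    simp
  have : Nonempty ι := ⟨i⟩
  rw [hsum] at h2
  simpa [Fintype.card_ne_zero] using h2.symm

/-- **Rellich's theorem**, local form: a real-analytic family of matrices that is Hermitian near
`t₀` can be diagonalized near `t₀` by a real-analytic family of unitary matrices. -/
theorem analyticDiagAt_of_isHermitian {ι : Type*} [Fintype ι] [DecidableEq ι]
    {A : ℝ → Matrix ι ι ℂ} {t₀ : ℝ}
    (hA : AnalyticAt ℝ A t₀) (hherm : ∀ᶠ t in 𝓝 t₀, (A t).IsHermitian) :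
    AnalyticDiagAt A t₀ := by
  induction hN : Fintype.card ι using Nat.strong_induction_on generalizing ι with
  | _ N ih =>
  let trCLM : Matrix ι ι ℂ →L[ℝ] ℂ := (traceLinearMap ι ℝ ℂ).toContinuousLinearMap
  let a : ℝ → ℝ := fun t => (trace (A t)).re / Fintype.card ι
  have ha : AnalyticAt ℝ a t₀ :=
    ((Complex.reCLM.comp trCLM).analyticAt _ |>.fun_comp hA).div_const
  have ha' : AnalyticAt ℝ (fun t => (a t : ℂ)) t₀ := (Complex.ofRealCLM.analyticAt _).fun_comp ha
  let B₀ : ℝ → Matrix ι ι ℂ := fun t => A t - (a t : ℂ) • (1 : Matrix ι ι ℂ)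
  have hB₀ : AnalyticAt ℝ B₀ t₀ := hA.sub (ha'.smul analyticAt_const)
  have hB₀herm : ∀ᶠ t in 𝓝 t₀, (B₀ t)ᴴ = B₀ t := by
    filter_upwards [hherm] with t ht
    simp [B₀, ht.eq]
  have hB₀tr : ∀ᶠ t in 𝓝 t₀, trace (B₀ t) = 0 := by
    filter_upwards [hherm] with t ht
    have him : (((trace (A t)).re : ℝ) : ℂ) = trace (A t) := by
      rw [← Complex.conj_eq_iff_re, starRingEnd_apply, ← trace_conjTranspose, ht.eq]
    rcases isEmpty_or_nonempty ι with h | h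
    · simp [trace]
    · simp [B₀, a, him]
  by_cases h0 : ∀ᶠ t in 𝓝 t₀, B₀ t = 0
  · refine AnalyticDiagAt.zero.smul_one_add_smul ha analyticAt_const (b := fun _ => 0) ?_
    filter_upwards [h0] with t ht
    simpa [B₀, sub_eq_zero] using ht
  obtain ⟨k, B, hB, hBne, hBeq⟩ := hB₀.exists_eventuallyEq_pow_smul_nonzero_iff.2 h0
  have hBherm : (fun t => (B t)ᴴ) =ᶠ[𝓝 t₀] B := by
    refine (ContinuousAt.eventuallyEq_nhds_iff_eventuallyEq_nhdsNE
      (continuous_id.matrix_conjTranspose.continuousAt.comp' hB.continuousAt) hB.continuousAt).1 ?_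
    filter_upwards [nhdsWithin_le_nhds hBeq, nhdsWithin_le_nhds hB₀herm, self_mem_nhdsWithin]
      with t h1 h2 h3
    have h4 : (t - t₀) ^ k ≠ 0 := pow_ne_zero _ (sub_ne_zero.2 h3)
    rw [h1, conjTranspose_smul, star_trivial] at h2
    exact smul_right_injective _ h4 h2
  have hBtr : (fun t => trace (B t)) =ᶠ[𝓝 t₀] fun _ => 0 := by
    refine (ContinuousAt.eventuallyEq_nhds_iff_eventuallyEq_nhdsNE
      (trCLM.continuous.continuousAt.comp' hB.continuousAt) continuousAt_const).1 ?_
    filter_upwards [nhdsWithin_le_nhds hBeq, nhdsWithin_le_nhds hB₀tr, self_mem_nhdsWithin]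
      with t h1 h2 h3
    have h4 : (t - t₀) ^ k ≠ 0 := pow_ne_zero _ (sub_ne_zero.2 h3)
    rw [h1, trace_smul] at h2
    exact (smul_eq_zero.1 h2).resolve_left h4
  have hM : (B t₀).IsHermitian := hBherm.self_of_nhds
  obtain ⟨i₀, j₀, hij⟩ := hM.exists_eigenvalues_ne hBtr.self_of_nhds hBne
  let V : Matrix ι ι ℂ := hM.eigenvectorUnitary
  have hV1 : Vᴴ * V = 1 := Unitary.coe_star_mul_self hM.eigenvectorUnitary
  have hV2 : V * Vᴴ = 1 := Unitary.coe_mul_star_self hM.eigenvectorUnitary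
  let C : ℝ → Matrix ι ι ℂ := fun t => Vᴴ * B t * V
  have hC : AnalyticAt ℝ C t₀ := (analyticAt_const.mul hB).mul analyticAt_const
  have hC₀ : C t₀ = diagonal fun i => (hM.eigenvalues i : ℂ) := by
    have := hM.conjStarAlgAut_star_eigenvectorUnitary
    rw [Unitary.conjStarAlgAut_star_apply] at this
    exact this
  have hCherm : ∀ᶠ t in 𝓝 t₀, (C t).IsHermitian := by
    filter_upwards [hBherm] with t ht
    simp only [IsHermitian, C, conjTranspose_mul, conjTranspose_conjTranspose, ht, mul_assoc]
  let p : ι → Prop := fun i => hM.eigenvalues i = hM.eigenvalues i₀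
  classical
  obtain ⟨W, X, hW, hX, hWX⟩ := exists_analyticAt_blockDiagonalization hC hCherm
    hM.eigenvalues hC₀ p fun i j hi hj h => hj (h.symm.trans hi)
  have hXentries := analyticAt_iff_entries.1 hX
  have hXdiag : AnalyticDiagAt X t₀ := by
    refine .of_blocks p (hWX.mono fun t ht => ht.2.2.2) ?_ ?_
    · refine ih _ (hN ▸ Fintype.card_subtype_lt (x := j₀) fun h => hij h.symm) ?_ ?_ rfl
      · exact analyticAt_iff_entries.2 fun i j => hXentries i j
      · exact hWX.mono fun t ht => ht.2.2.1.submatrix _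
    · refine ih _ (hN ▸ Fintype.card_subtype_lt (x := i₀) fun h => h rfl) ?_ ?_ rfl
      · exact analyticAt_iff_entries.2 fun i j => hXentries i j
      · exact hWX.mono fun t ht => ht.2.2.1.submatrix _
  have hCdiag : AnalyticDiagAt C t₀ := hXdiag.of_conj hW (hWX.mono fun t ht => ⟨ht.1, ht.2.1⟩)
  have hBdiag : AnalyticDiagAt B t₀ := by
    refine hCdiag.of_conj (W := fun _ => V) analyticAt_const (.of_forall fun t => ⟨hV1, ?_⟩)
    simp only [C, ← mul_assoc, hV2, one_mul]
  refine hBdiag.smul_one_add_smul (b := fun t => (t - t₀) ^ k) ha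
    ((analyticAt_id.sub analyticAt_const).pow k) ?_
  filter_upwards [hBeq] with t ht
  have h5 : A t = (a t : ℂ) • (1 : Matrix ι ι ℂ) + B₀ t := by simp [B₀]
  rw [h5, ht]
  congr 1

/-- On `s`, the columns of the unitary matrices `U t` are eigenvectors of `A t` with eigenvalues
`D t`, where `U` is continuous and `D` is real-analytic. -/
structure IsDiagOn (A : ℝ → Matrix ι ι ℂ) (s : Set ℝ) (U : ℝ → Matrix ι ι ℂ)
    (D : ℝ → ι → ℝ) : Prop where
  continuousAt : ∀ t ∈ s, ContinuousAt U t
  analyticAt : ∀ t ∈ s, ∀ i, AnalyticAt ℝ (fun t => D t i) t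
  conjTranspose_mul_self : ∀ t ∈ s, (U t)ᴴ * U t = 1
  mul_eq : ∀ t ∈ s, A t * U t = U t * diagonal fun i => (D t i : ℂ)

theorem AnalyticDiagAt.exists_isDiagOn {A : ℝ → Matrix ι ι ℂ} {t₀ : ℝ}
    (h : AnalyticDiagAt A t₀) :
    ∃ ε > 0, ∃ U D, IsDiagOn A (Set.Ioo (t₀ - ε) (t₀ + ε)) U D := by
  obtain ⟨U, D, hU, hD, hUD⟩ := h
  have hall := (hU.eventually_analyticAt.and
    ((eventually_all.2 fun i => (hD i).eventually_analyticAt).and hUD))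
  obtain ⟨ε, hε, hball⟩ := Metric.eventually_nhds_iff_ball.1 hall
  rw [Real.ball_eq_Ioo] at hball
  exact ⟨ε, hε, U, D, fun t ht => (hball t ht).1.continuousAt, fun t ht => (hball t ht).2.1,
    fun t ht => (hball t ht).2.2.1, fun t ht => (hball t ht).2.2.2⟩

namespace IsDiagOn

variable {A U U' : ℝ → Matrix ι ι ℂ} {D D' : ℝ → ι → ℝ} {s s' : Set ℝ}

theorem mono (h : IsDiagOn A s U D) (hs : s' ⊆ s) : IsDiagOn A s' U D :=
  ⟨fun t ht => h.1 t (hs ht), fun t ht => h.2 t (hs ht), fun t ht => h.3 t (hs ht),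
    fun t ht => h.4 t (hs ht)⟩

theorem congr (h : ∀ t ∈ s, ∃ U D, IsDiagOn A s U D ∧ U =ᶠ[𝓝 t] U' ∧ D =ᶠ[𝓝 t] D') :
    IsDiagOn A s U' D' := by
  refine ⟨fun t ht => ?_, fun t ht i => ?_, fun t ht => ?_, fun t ht => ?_⟩ <;>
    obtain ⟨U, D, hUD, hU, hD⟩ := h t ht
  · exact (hUD.1 t ht).congr hU
  · exact (hUD.2 t ht i).congr (hD.mono fun x hx => congrFun hx i)
  · rw [← hU.self_of_nhds]; exact hUD.3 t ht
  · rw [← hU.self_of_nhds, ← hD.self_of_nhds]; exact hUD.4 t ht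

theorem comp_neg (h : IsDiagOn (fun t => A (-t)) s U D) :
    IsDiagOn A (-s) (fun t => U (-t)) fun t => D (-t) := by
  refine ⟨fun t ht => ?_, fun t ht i => ?_, fun t ht => h.3 _ ht, fun t ht => ?_⟩
  · exact ContinuousAt.comp' (h.1 _ ht) continuousAt_neg
  · exact (h.2 _ ht i).fun_comp analyticAt_id.neg
  · simpa using h.4 _ ht

/-- If two columns of continuous diagonalizations are not orthogonal at an interior point, the
corresponding eigenvalues agree near this point. -/
theorem eventuallyEq_of_ne_zero (h : IsDiagOn A s U D) (h' : IsDiagOn A s' U' D') {c : ℝ}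
    (hs : s ∈ 𝓝 c) (hs' : s' ∈ 𝓝 c) (hA : ∀ t, (A t).IsHermitian) {i j : ι}
    (hij : ((U' c)ᴴ * U c) i j ≠ 0) : (fun t => D' t i) =ᶠ[𝓝 c] fun t => D t j := by
  have hcont : ContinuousAt (fun t => ((U' t)ᴴ * U t) i j) c := by
    have h1 : ContinuousAt (fun t => (U' t)ᴴ) c :=
      continuous_id.matrix_conjTranspose.continuousAt.comp' (h'.1 c (mem_of_mem_nhds hs'))
    exact (continuous_id.matrix_elem i j).continuousAt.comp'
      (h1.mul (h.1 c (mem_of_mem_nhds hs)))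
  filter_upwards [hcont.eventually_ne hij, hs, hs'] with t ht hts hts'
  have h1 : (U' t)ᴴ * A t = (diagonal fun i => (D' t i : ℂ)) * (U' t)ᴴ := by
    have := congrArg conjTranspose (h'.4 t hts')
    simpa [conjTranspose_mul, (hA t).eq, diagonal_conjTranspose, Pi.star_def] using this
  have h2 : (diagonal fun i => (D' t i : ℂ)) * ((U' t)ᴴ * U t) =
      ((U' t)ᴴ * U t) * diagonal fun i => (D t i : ℂ) := by
    rw [← mul_assoc, ← h1, mul_assoc, h.4 t hts, mul_assoc]
  have h3 := congrFun (congrFun h2 i) j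
  rw [diagonal_mul, mul_diagonal, mul_comm] at h3
  exact_mod_cast mul_left_cancel₀ ht h3

/-- Two diagonalizations can be glued at a common interior point, leaving the first one unchanged
to the left of this point. -/
theorem exists_glue (h : IsDiagOn A s U D) (h' : IsDiagOn A s' U' D') {c : ℝ}
    (hs : s ∈ 𝓝 c) (hs' : s' ∈ 𝓝 c) (hconn : IsPreconnected s') (hA : ∀ t, (A t).IsHermitian) :
    ∃ V E, IsDiagOn A (s ∩ Set.Iic c ∪ s' ∩ Set.Ici c) V E ∧
      ∀ t ≤ c, V t = U t ∧ E t = D t := by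
  have hcs := mem_of_mem_nhds hs
  have hcs' := mem_of_mem_nhds hs'
  set W : Matrix ι ι ℂ := (U' c)ᴴ * U c with hW
  have hU'c : U' c * (U' c)ᴴ = 1 := mul_eq_one_comm.1 (h'.3 c hcs')
  have hUW : U' c * W = U c := by rw [hW, ← mul_assoc, hU'c, one_mul]
  have hWW : Wᴴ * W = 1 := by
    rw [hW, conjTranspose_mul, conjTranspose_conjTranspose, mul_assoc, ← mul_assoc (U' c), hU'c,
      one_mul, h.3 c hcs]
  have hex : ∀ j, ∃ i, W i j ≠ 0 := by
    intro j
    by_contra! hall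
    have := congrFun (congrFun hWW j) j
    simp [mul_apply, hall] at this
  choose f hf using hex
  have hnear : ∀ i j, W i j ≠ 0 → (fun t => D' t i) =ᶠ[𝓝 c] fun t => D t j := fun i j hij =>
    h.eventuallyEq_of_ne_zero h' hs hs' hA hij
  have hall : ∀ i j, W i j ≠ 0 → ∀ t ∈ s', D' t i = D' t (f j) := by
    intro i j hij
    exact AnalyticOnNhd.eqOn_of_preconnected_of_eventuallyEq (fun t ht => h'.2 t ht i)
      (fun t ht => h'.2 t ht (f j)) hconn hcs' ((hnear i j hij).trans (hnear _ j (hf j)).symm)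
  have hcomm : ∀ t ∈ s', (diagonal fun i => (D' t i : ℂ)) * W =
      W * diagonal fun j => (D' t (f j) : ℂ) := by
    intro t ht
    ext i j
    rw [diagonal_mul, mul_diagonal]
    by_cases hij : W i j = 0
    · simp [hij]
    · rw [hall i j hij t ht, mul_comm]
  have hV : ∀ t, (if t ≤ c then U t else U' t * W) =
      U (min t c) - U c + U' (max t c) * W := by
    intro t
    split_ifs with ht
    · rw [min_eq_left ht, max_eq_right ht, hUW, sub_add_cancel]
    · rw [min_eq_right (not_le.1 ht).le, max_eq_left (not_le.1 ht).le, sub_self, zero_add]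
  refine ⟨fun t => if t ≤ c then U t else U' t * W,
    fun t => if t ≤ c then D t else fun j => D' t (f j), ⟨?_, ?_, ?_, ?_⟩, ?_⟩
  · intro t ht
    have hmin : min t c ∈ s := by
      rcases ht with ⟨h1, h2⟩ | ⟨h1, h2⟩
      · rwa [min_eq_left h2]
      · rwa [min_eq_right h2]
    have hmax : max t c ∈ s' := by
      rcases ht with ⟨h1, h2⟩ | ⟨h1, h2⟩
      · rwa [max_eq_right h2]
      · rwa [max_eq_left h2]
    simp_rw [hV]
    have c1 : ContinuousAt (fun t => U (min t c)) t :=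
      ContinuousAt.comp' (h.1 _ hmin) (continuous_id.min continuous_const).continuousAt
    have c2 : ContinuousAt (fun t => U' (max t c)) t :=
      ContinuousAt.comp' (h'.1 _ hmax) (continuous_id.max continuous_const).continuousAt
    exact (c1.sub continuousAt_const).add (c2.mul continuousAt_const)
  · intro t ht j
    rcases lt_trichotomy t c with hlt | rfl | hlt
    · have hts : t ∈ s := ht.elim And.left fun h => absurd h.2 (not_le.2 hlt)
      refine (h.2 t hts j).congr ?_
      filter_upwards [Iio_mem_nhds hlt] with x hx
      rw [if_pos (le_of_lt hx)]
    · refine (h.2 t hcs j).congr ?_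
      filter_upwards [hnear _ j (hf j)] with x hx
      split_ifs
      · rfl
      · exact hx.symm
    · have hts : t ∈ s' := ht.elim (fun h => absurd h.2 (not_le.2 hlt)) And.left
      refine (h'.2 t hts (f j)).congr ?_
      filter_upwards [Ioi_mem_nhds hlt] with x hx
      rw [if_neg (not_le.2 hx)]
  · intro t ht
    by_cases htc : t ≤ c
    · have hts : t ∈ s := ht.elim And.left fun h => le_antisymm htc h.2 ▸ hcs
      simpa only [if_pos htc] using h.3 t hts
    · have hts : t ∈ s' := ht.elim (fun h => absurd h.2 htc) And.left
      simp only [if_neg htc]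
      rw [conjTranspose_mul, mul_assoc, ← mul_assoc (U' t)ᴴ, h'.3 t hts, one_mul, hWW]
  · intro t ht
    by_cases htc : t ≤ c
    · have hts : t ∈ s := ht.elim And.left fun h => le_antisymm htc h.2 ▸ hcs
      simpa only [if_pos htc] using h.4 t hts
    · have hts : t ∈ s' := ht.elim (fun h => absurd h.2 htc) And.left
      simp only [if_neg htc]
      rw [← mul_assoc, h'.4 t hts, mul_assoc, hcomm t hts, ← mul_assoc]
  · intro t ht
    simp only [if_pos ht, and_self]

theorem exists_extend_right (hA : ∀ t, AnalyticAt ℝ A t) (hherm : ∀ t, (A t).IsHermitian)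
    {a b c : ℝ} (h : IsDiagOn A (Set.Ioo a b) U D) (hac : a < c) (hcb : c < b) (y : ℝ) :
    ∃ V E, IsDiagOn A (Set.Ioo a y) V E ∧ ∀ t ≤ c, V t = U t ∧ E t = D t := by
  let S : Set ℝ := {x | c < x ∧ ∃ V E, IsDiagOn A (Set.Ioo a x) V E ∧
    ∀ t ≤ c, V t = U t ∧ E t = D t}
  by_contra hcon
  have hbS : b ∈ S := ⟨hcb, U, D, h, fun _ _ => ⟨rfl, rfl⟩⟩
  have hbdd : BddAbove S := by
    refine ⟨y, fun x ⟨_, V, E, hVE, hag⟩ => ?_⟩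
    by_contra! hxy
    exact hcon ⟨V, E, hVE.mono (Set.Ioo_subset_Ioo_right hxy.le), hag⟩
  obtain ⟨ε, hε, U', D', h'⟩ := (analyticDiagAt_of_isHermitian (hA (sSup S))
    (.of_forall hherm)).exists_isDiagOn
  obtain ⟨x, ⟨hcx, V, E, hVE, hag⟩, hx⟩ := exists_lt_of_lt_csSup ⟨b, hbS⟩
    (sub_lt_self (sSup S) hε)
  have hxS : x ≤ sSup S := le_csSup hbdd ⟨hcx, V, E, hVE, hag⟩
  obtain ⟨c', hc', hc'x⟩ := exists_between (max_lt hcx hx)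
  obtain ⟨hcc', hsc'⟩ := max_lt_iff.1 hc'
  obtain ⟨V', E', hVE', hag'⟩ := hVE.exists_glue h' (Ioo_mem_nhds (hac.trans hcc') hc'x)
    (Ioo_mem_nhds hsc' (by linarith)) isPreconnected_Ioo hherm
  have hmem : sSup S + ε ∈ S := by
    refine ⟨by linarith, V', E', hVE'.mono fun t ht => ?_, fun t ht => ?_⟩
    · rcases le_total t c' with htc | htc
      · exact .inl ⟨⟨ht.1, htc.trans_lt hc'x⟩, htc⟩
      · exact .inr ⟨⟨hsc'.trans_le htc, ht.2⟩, htc⟩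
    · rw [(hag' t (ht.trans hcc'.le)).1, (hag' t (ht.trans hcc'.le)).2]
      exact hag t ht
  linarith [le_csSup hbdd hmem]

end IsDiagOn

theorem exists_isDiagOn_Ioi {A : ℝ → Matrix ι ι ℂ} (hA : ∀ t, AnalyticAt ℝ A t)
    (hherm : ∀ t, (A t).IsHermitian) : ∃ a < 0, ∃ U D, IsDiagOn A (Set.Ioi a) U D := by
  obtain ⟨ε, hε, U₀, D₀, h₀⟩ := (analyticDiagAt_of_isHermitian (hA 0)
    (.of_forall hherm)).exists_isDiagOn
  rw [zero_sub, zero_add] at h₀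
  have ha : ∀ k : ℕ, -ε < k := fun k => by have : (0 : ℝ) ≤ k := k.cast_nonneg; linarith
  obtain ⟨U₁, D₁, h₁, -⟩ := h₀.exists_extend_right hA hherm (c := 0) (by linarith) hε 1
  let T : ℕ → Type _ := fun k => {P : (ℝ → Matrix ι ι ℂ) × (ℝ → ι → ℝ) //
    IsDiagOn A (Set.Ioo (-ε) (k + 1)) P.1 P.2}
  have step : ∀ (k : ℕ) (P : T k), ∃ Q : T (k + 1), ∀ t ≤ (k : ℝ),
      Q.1.1 t = P.1.1 t ∧ Q.1.2 t = P.1.2 t := by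
    intro k P
    obtain ⟨V, E, hVE, hag⟩ := P.2.exists_extend_right hA hherm (c := k) (ha k) (by simp)
      ((k + 1 : ℕ) + 1)
    exact ⟨⟨(V, E), hVE⟩, hag⟩
  choose next hnext using step
  let F : ∀ k, T k := fun k => Nat.rec ⟨(U₁, D₁), by simpa using h₁⟩ (fun k P => next k P) k
  have hF : ∀ (k m : ℕ), k ≤ m → ∀ t ≤ (k : ℝ),
      (F m).1.1 t = (F k).1.1 t ∧ (F m).1.2 t = (F k).1.2 t := by
    intro k m hkm t ht
    induction m, hkm using Nat.le_induction with
    | base => exact ⟨rfl, rfl⟩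
    | succ m hkm ih =>
      have := hnext m (F m) t (ht.trans (by exact_mod_cast hkm))
      exact ⟨this.1.trans ih.1, this.2.trans ih.2⟩
  refine ⟨-ε, by linarith, fun t => (F ⌈t⌉₊).1.1 t, fun t => (F ⌈t⌉₊).1.2 t, ?_⟩
  have key : ∀ k : ℕ, IsDiagOn A (Set.Ioo (-ε) k) (fun t => (F ⌈t⌉₊).1.1 t)
      fun t => (F ⌈t⌉₊).1.2 t := by
    intro k
    refine IsDiagOn.congr fun t ht => ⟨(F k).1.1, (F k).1.2,
      (F k).2.mono (Set.Ioo_subset_Ioo_right (by simp)), ?_, ?_⟩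
    all_goals
      filter_upwards [Iio_mem_nhds ht.2] with x hx
      have := hF ⌈x⌉₊ k (Nat.ceil_le.2 (le_of_lt hx)) x (Nat.le_ceil x)
    · exact this.1
    · exact this.2
  have hmem : ∀ t ∈ Set.Ioi (-ε), t ∈ Set.Ioo (-ε) ((⌊t⌋₊ + 1 : ℕ) : ℝ) := fun t ht =>
    ⟨ht, by exact_mod_cast Nat.lt_floor_add_one t⟩
  exact ⟨fun t ht => (key _).1 t (hmem t ht), fun t ht => (key _).2 t (hmem t ht),
    fun t ht => (key _).3 t (hmem t ht), fun t ht => (key _).4 t (hmem t ht)⟩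

/-- **Rellich's theorem**, global form: a real-analytic family of Hermitian matrices on the real
line has real-analytic eigenvalues and a continuous family of unitary eigenvector matrices. -/
theorem exists_isDiagOn_univ {A : ℝ → Matrix ι ι ℂ}
    (hentries : ∀ t i j, AnalyticAt ℝ (fun t => A t i j) t)
    (hherm : ∀ t, (A t).IsHermitian) : ∃ U D, IsDiagOn A Set.univ U D := by
  have hA : ∀ t, AnalyticAt ℝ A t := fun t => analyticAt_iff_entries.2 (hentries t)
  obtain ⟨a, ha, U, D, h⟩ := exists_isDiagOn_Ioi hA hherm
  obtain ⟨b, hb, U', D', h'⟩ := exists_isDiagOn_Ioi (A := fun t => A (-t))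
    (fun t => (hA (-t)).fun_comp analyticAt_id.neg) fun t => hherm (-t)
  have hneg : -Set.Ioi b = Set.Iio (-b) := by simp
  have h'' := h'.comp_neg
  rw [hneg] at h''
  obtain ⟨V, E, hVE, -⟩ := h''.exists_glue h (c := 0) (Iio_mem_nhds (by linarith))
    (Ioi_mem_nhds ha) isPreconnected_Ioi hherm
  refine ⟨V, E, hVE.mono fun t _ => ?_⟩
  rcases le_total t 0 with ht | ht
  · exact .inl ⟨Set.mem_Iio.2 (by linarith), ht⟩
  · exact .inr ⟨Set.mem_Ioi.2 (by linarith), ht⟩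

end Matrix

end

open scoped ComplexConjugate

/-- Continuous diagonalization of a polynomial family of matrices that is Hermitian
over the reals (Proposition on continuous diagonalization). -/
theorem continuous_diagonalization
    (n : ℕ) (hn : 1 ≤ n) (L : ℂ → Matrix (Fin n) (Fin n) ℂ)
    (hpoly : ∀ i j : Fin n, ∃ p : Polynomial ℂ, ∀ t : ℂ, L t i j = p.eval t)
    (hherm : ∀ t : ℝ, (L (t : ℂ)).IsHermitian) :
    ∃ (v : Fin n → ℝ → (Fin n → ℂ)) (η : Fin n → ℝ → ℝ),
      (∀ i, Continuous (v i)) ∧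
      (∀ i, Continuous (η i)) ∧
      (∀ t : ℝ, LinearIndependent ℂ (fun i => v i t)) ∧
      (∀ t : ℝ, Submodule.span ℂ (Set.range fun i => v i t) = ⊤) ∧
      (∀ t : ℝ, ∀ i j : Fin n, i ≠ j → ∑ k, v i t k * conj (v j t k) = 0) ∧
      (∀ t : ℝ, ∀ i : Fin n, (L (t : ℂ)).mulVec (v i t) = (η i t : ℂ) • v i t) := by
  have hA : ∀ (t₀ : ℝ) (i j : Fin n), AnalyticAt ℝ (fun t : ℝ => L (t : ℂ) i j) t₀ := by
    intro t₀ i j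
    obtain ⟨p, hp⟩ := hpoly i j
    simp_rw [hp]
    have h1 : AnalyticAt ℝ (fun z : ℂ => p.eval z) (t₀ : ℂ) :=
      (AnalyticOnNhd.eval_polynomial (𝕜 := ℂ) p _ (Set.mem_univ _)).restrictScalars
    exact h1.fun_comp (Complex.ofRealCLM.analyticAt t₀)
  obtain ⟨U, D, h⟩ := Matrix.exists_isDiagOn_univ hA hherm
  have hli : ∀ t : ℝ, LinearIndependent ℂ fun i => (U t).col i := fun t =>
    Matrix.linearIndependent_cols_iff_isUnit.2
      (IsUnit.of_mul_eq_one _ (mul_eq_one_comm.1 (h.conjTranspose_mul_self t trivial)))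
  refine ⟨fun i t => (U t).col i, fun i t => D t i, fun i => ?_, fun i => ?_, hli, fun t => ?_,
    fun t i j hij => ?_, fun t i => ?_⟩
  · have hU : Continuous U := continuous_iff_continuousAt.2 fun t => h.continuousAt t trivial
    exact continuous_pi fun k => hU.matrix_elem k i
  · exact continuous_iff_continuousAt.2 fun t => (h.analyticAt t trivial i).continuousAt
  · exact (hli t).span_eq_top_of_card_eq_finrank' (by simp)
  · have := congrFun (congrFun (h.conjTranspose_mul_self t trivial) j) i
    rw [Matrix.mul_apply, Matrix.one_apply_ne hij.symm] at this
    rw [← this]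
    exact Finset.sum_congr rfl fun k _ => mul_comm _ _
  · ext k
    have := congrFun (congrFun (h.mul_eq t trivial) k) i
    rw [Matrix.mul_diagonal] at this
    change (L t * U t) k i = _
    simpa [mul_comm] using this
end

section
/- Let n ≥ 1 and let L : ℂ → Mₙ(ℂ) be a map whose matrix entries are polynomial functions of the complex variable t. Then there exists a finite subset S ⊂ ℂ such that for all t₁, t₂ ∈ ℂ ∖ S, the characteristic polynomials of L(t₁) and L(t₂) have the same number of distinct complex roots, and the multiset of root multiplicities of the characteristic polynomial of L(t₁) equals that of L(t₂). In particular, on ℂ ∖ S the matrices L(t) have a constant number of distinct eigenvalues with constant multiset of multiplicities. -/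
/-- A homomorphism to an algebraically closed field extends along an injective integral
extension. -/
theorem exists_ringHom_extending_of_isIntegral {R A F : Type*} [CommRing R] [CommRing A]
    [Algebra R A] [Algebra.IsIntegral R A] [FaithfulSMul R A] [Field F] [IsAlgClosed F]
    (f : R →+* F) : ∃ φ : A →+* F, φ.comp (algebraMap R A) = f := by
  have : (RingHom.ker f).IsPrime := RingHom.ker_isPrime f
  obtain ⟨⟨Q, hQ, hQf⟩⟩ := Ideal.nonempty_primesOver (S := A) (RingHom.ker f)
  have : IsDomain (R ⧸ RingHom.ker f) := Ideal.Quotient.isDomain _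
  have : IsDomain (A ⧸ Q) := Ideal.Quotient.isDomain _
  let _ : Algebra (R ⧸ RingHom.ker f) F := f.kerLift.toAlgebra
  have : FaithfulSMul (R ⧸ RingHom.ker f) F :=
    (faithfulSMul_iff_algebraMap_injective _ _).mpr f.kerLift_injective
  have : Algebra.IsIntegral (R ⧸ RingHom.ker f) (A ⧸ Q) := inferInstance
  have : Module.IsTorsionFree (R ⧸ RingHom.ker f) (A ⧸ Q) :=
    Module.isTorsionFree_iff_faithfulSMul.mpr inferInstance
  let ψ : A ⧸ Q →ₐ[R ⧸ RingHom.ker f] F := IsAlgClosed.lift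
  refine ⟨(ψ : A ⧸ Q →+* F).comp (Ideal.Quotient.mk Q), RingHom.ext fun r => ?_⟩
  exact ψ.commutes (Ideal.Quotient.mk _ r)

open Polynomial in
/-- A monic polynomial splits over the integral closure of its
coefficient ring in an algebraically closed field. -/
theorem Polynomial.Monic.exists_map_integralClosure_eq_prod {R K : Type*} [CommRing R] [Field K]
    [IsAlgClosed K] [Algebra R K] {P : R[X]} (hP : P.Monic) :
    ∃ s : Multiset (integralClosure R K),
      P.map (algebraMap R (integralClosure R K)) = (s.map fun a => X - C a).prod := by
  have hint : ∀ a ∈ P.aroots K, a ∈ integralClosure R K := fun a ha =>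
    ⟨P, hP, by simpa [aeval_def] using (mem_aroots'.mp ha).2⟩
  refine ⟨(P.aroots K).attach.map fun a => ⟨a.1, hint a.1 a.2⟩, ?_⟩
  apply map_injective (algebraMap (integralClosure R K) K) Subtype.val_injective
  rw [Polynomial.map_map, ← IsScalarTower.algebraMap_eq, Polynomial.map_multiset_prod,
    (IsAlgClosed.splits (P.map (algebraMap R K))).eq_prod_roots_of_monic (hP.map _)]
  simp only [Multiset.map_map, Function.comp_def, Polynomial.map_sub, map_X, map_C]
  exact congrArg Multiset.prod (Multiset.attach_map_val' (P.aroots K) fun a => X - C a).symm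

/-- Multiplicities of a multiset are unchanged by a map injective on it. -/
theorem Multiset.map_count_toFinset_map_of_injOn {α β : Type*} [DecidableEq α] [DecidableEq β]
    (s : Multiset α) (f : α → β) (hf : Set.InjOn f {a | a ∈ s}) :
    (s.map f).toFinset.val.map (fun b => (s.map f).count b)
      = s.toFinset.val.map fun a => s.count a := by
  rw [Multiset.toFinset_map, Finset.image_val_of_injOn (by simpa [Set.InjOn] using hf),
    Multiset.map_map]
  refine Multiset.map_congr rfl fun a ha => ?_
  exact Multiset.count_map_eq_count f s hf a (by simpa using ha)

open Polynomial in
/-- The root multiplicities of a monic polynomial over an integral domain are the same in all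
specializations to an algebraically closed field that do not kill a certain nonzero element. -/
theorem Polynomial.Monic.exists_rootMultiplicity_specialization_eq {R F : Type*} [CommRing R]
    [IsDomain R] [Field F] [IsAlgClosed F] [DecidableEq F] {P : R[X]} (hP : P.Monic) :
    ∃ d : R, d ≠ 0 ∧ ∃ m : Multiset ℕ, ∀ f : R →+* F, f d ≠ 0 →
      (P.map f).roots.toFinset.val.map (fun z => rootMultiplicity z (P.map f)) = m := by
  classical
  let K := AlgebraicClosure (FractionRing R)
  let A := integralClosure R K
  have : FaithfulSMul R K := (faithfulSMul_iff_algebraMap_injective R K).mpr <| by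
    rw [IsScalarTower.algebraMap_eq R (FractionRing R) K]
    exact (algebraMap (FractionRing R) K).injective.comp (IsFractionRing.injective R _)
  have : FaithfulSMul R A := inferInstance
  obtain ⟨s, hs⟩ := hP.exists_map_integralClosure_eq_prod (K := K)
  let D : A := ∏ p ∈ s.toFinset.offDiag, (p.1 - p.2)
  have hD : D ≠ 0 := Finset.prod_ne_zero_iff.mpr fun p hp =>
    sub_ne_zero.mpr (Finset.mem_offDiag.mp hp).2.2
  obtain ⟨d, hd, hd0⟩ := Submodule.exists_mem_ne_zero_of_ne_bot <|
    Ideal.comap_ne_bot_of_integral_mem (R := R) hD (Ideal.mem_span_singleton_self D)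
      (Algebra.IsIntegral.isIntegral D)
  refine ⟨d, hd0, s.toFinset.val.map fun a => s.count a, fun f hf => ?_⟩
  obtain ⟨φ, hφ⟩ := exists_ringHom_extending_of_isIntegral (A := A) f
  have hroots : (P.map f).roots = s.map φ := by
    rw [← hφ, ← Polynomial.map_map, hs, Polynomial.map_multiset_prod, Multiset.map_map]
    simpa [Function.comp_def] using roots_multiset_prod_X_sub_C (s.map φ)
  have hφD : φ D ≠ 0 := fun h => hf <| by
    obtain ⟨e, he⟩ := Ideal.mem_span_singleton.mp (Ideal.mem_comap.mp hd)
    rw [← hφ, RingHom.comp_apply, he, map_mul, h, zero_mul]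
  have hinj : Set.InjOn φ {a | a ∈ s} := fun a ha b hb hab => by
    by_contra hne
    rw [map_prod, Finset.prod_ne_zero_iff] at hφD
    exact hφD (a, b) (by simpa [hne] using ⟨ha, hb⟩) (by simp [hab])
  simp_rw [← count_roots, hroots]
  exact s.map_count_toFinset_map_of_injOn φ hinj


/-- For a polynomial family `L : ℂ → Mₙ(ℂ)`, off a finite set `S` the characteristic
polynomial of `L t` has a constant number of distinct roots with constant multiset of
root multiplicities. -/
theorem constant_eigenvalue_structure_off_finite_set
    (n : ℕ) (hn : 1 ≤ n) (L : ℂ → Matrix (Fin n) (Fin n) ℂ)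
    (hpoly : ∀ i j : Fin n, ∃ p : Polynomial ℂ, ∀ t : ℂ, L t i j = p.eval t) :
    ∃ S : Finset ℂ, ∀ t₁ ∉ S, ∀ t₂ ∉ S,
      ((L t₁).charpoly.roots.toFinset.card = (L t₂).charpoly.roots.toFinset.card) ∧
      ((L t₁).charpoly.roots.toFinset.val.map
          (fun z => Polynomial.rootMultiplicity z (L t₁).charpoly)
        = (L t₂).charpoly.roots.toFinset.val.map
          (fun z => Polynomial.rootMultiplicity z (L t₂).charpoly)) := by
  choose p hp using hpoly
  obtain ⟨d, hd, m, hm⟩ := Polynomial.Monic.exists_rootMultiplicity_specialization_eq (F := ℂ)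
    (Matrix.charpoly_monic (Matrix.of p))
  have key : ∀ t ∉ d.roots.toFinset, (L t).charpoly.roots.toFinset.val.map
      (fun z => Polynomial.rootMultiplicity z (L t).charpoly) = m := fun t ht => by
    have hL : (Matrix.of p).map (Polynomial.evalRingHom t) = L t := by
      ext i j
      simp [hp]
    rw [← hL, Matrix.charpoly_map]
    convert hm (Polynomial.evalRingHom t) (by simpa [hd] using ht)
  refine ⟨d.roots.toFinset, fun t₁ h₁ t₂ h₂ => ?_⟩
  have h := (key t₁ h₁).trans (key t₂ h₂).symm
  exact ⟨by simpa only [Multiset.card_map, Finset.card_val] using congrArg Multiset.card h, h⟩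
end

section
/- Let X_ℓ, X_r ∈ Mₙ(ℂ) be skew-Hermitian and set Y(t) = i((1−t)·X_ℓ + t·X_r) for t ∈ [0,1], so each Y(t) is Hermitian. Then there exists a finite subset S = {s₀ < s₁ < ⋯ < s_d} ⊆ [0,1] containing 0 and 1 such that on each open interval (s_{k−1}, s_k), the number of positive eigenvalues of Y(t) counted with multiplicity is constant, and moreover the multiset of multiplicities of the positive eigenvalues of Y(t) is constant. -/
open scoped Matrix
open Polynomial Filter Topology
open scoped Kronecker

/-- The multiplicity of `0` as an eigenvalue is generically constant in a polynomial family
of matrices. -/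
theorem Matrix.exists_finite_rootMultiplicity_zero_charpoly_map_eval {R ι : Type*} [CommRing R]
    [IsDomain R] [Fintype ι] [DecidableEq ι] (M : Matrix ι ι R[X]) :
    ∃ (B : Set R) (k : ℕ), B.Finite ∧
      ∀ t ∉ B, (M.map (Polynomial.eval t)).charpoly.rootMultiplicity 0 = k := by
  have hne : M.charpoly ≠ 0 := M.charpoly_monic.ne_zero
  set k := M.charpoly.natTrailingDegree with hk
  have hc : M.charpoly.coeff k ≠ 0 := by
    rw [hk, ← Polynomial.trailingCoeff, Ne, Polynomial.trailingCoeff_eq_zero]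
    exact hne
  refine ⟨{t | (M.charpoly.coeff k).IsRoot t}, k, Polynomial.finite_setOfPred_isRoot hc,
    fun t ht ↦ ?_⟩
  have hmap : (M.map (Polynomial.eval t)).charpoly
      = M.charpoly.map (Polynomial.evalRingHom t) :=
    Matrix.charpoly_map M (Polynomial.evalRingHom t)
  rw [hmap, Polynomial.rootMultiplicity_eq_natTrailingDegree']
  refine le_antisymm (Polynomial.natTrailingDegree_le_of_ne_zero ?_) ?_
  · simpa [Polynomial.coeff_map] using ht
  · refine Polynomial.le_natTrailingDegree ?_ fun m hm ↦ ?_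
    · exact (M.charpoly_monic.map _).ne_zero
    · rw [Polynomial.coeff_map, Polynomial.coeff_eq_zero_of_lt_natTrailingDegree (hk ▸ hm),
        map_zero]

theorem Polynomial.rootMultiplicity_zero_prod_X_sub_C {R ι : Type*} [CommRing R] [IsDomain R]
    [DecidableEq R] [Fintype ι] (f : ι → R) :
    (∏ i, (X - C (f i))).rootMultiplicity 0 = (Finset.univ.filter fun i ↦ f i = 0).card := by
  rw [← Polynomial.count_roots, Polynomial.roots_prod _ _
    (Finset.prod_ne_zero_iff.2 fun i _ ↦ X_sub_C_ne_zero _)]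
  simp [Multiset.count_map, Finset.card, eq_comm]

/-- Antitone families with the same monic polynomial `∏ i, (z - μ i)` agree. -/
theorem Antitone.eq_of_forall_prod_sub_eq {m : ℕ} {μ ν : Fin m → ℝ} (hμ : Antitone μ)
    (hν : Antitone ν) (h : ∀ z : ℝ, ∏ i, (z - μ i) = ∏ i, (z - ν i)) : μ = ν := by
  have hp : ∏ i, (X - C (μ i)) = ∏ i, (X - C (ν i)) := by
    refine Polynomial.funext fun z ↦ ?_
    simpa [Polynomial.eval_prod] using h z
  have hr : Finset.univ.val.map μ = Finset.univ.val.map ν := by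
    have := congrArg Polynomial.roots hp
    rw [Polynomial.roots_prod _ _ (Finset.prod_ne_zero_iff.2 fun i _ ↦ X_sub_C_ne_zero _),
      Polynomial.roots_prod _ _ (Finset.prod_ne_zero_iff.2 fun i _ ↦ X_sub_C_ne_zero _)] at this
    simpa using this
  rw [Fin.univ_val_map, Fin.univ_val_map, Multiset.coe_eq_coe] at hr
  exact List.ofFn_injective
    (hr.eq_of_sortedGE hμ.sortedGE_ofFn hν.sortedGE_ofFn)

section

open scoped Matrix.Norms.Operator

theorem Matrix.IsHermitian.norm_eigenvalues₀_le {n : Type*} [Fintype n] [DecidableEq n]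
    {A : Matrix n n ℂ} (hA : A.IsHermitian) :
    ‖hA.eigenvalues₀‖ ≤ ‖A‖ * ‖(1 : Matrix n n ℂ)‖ := by
  refine (pi_norm_le_iff_of_nonneg (by positivity)).2 fun i ↦ ?_
  have h := hA.eigenvalues_mem_spectrum_real (Fintype.equivOfCardEq (Fintype.card_fin _) i)
  rw [Matrix.IsHermitian.eigenvalues, Equiv.symm_apply_apply] at h
  exact spectrum.norm_le_norm_mul_of_mem h

/-- The sorted eigenvalues of a Hermitian matrix depend continuously on the matrix. -/
theorem Matrix.IsHermitian.continuous_eigenvalues₀ {T n : Type*} [TopologicalSpace T] [Fintype n]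
    [DecidableEq n] {H : T → Matrix n n ℂ} (hc : Continuous H) (hH : ∀ t, (H t).IsHermitian) :
    Continuous fun t ↦ (hH t).eigenvalues₀ := by
  have hprod (t : T) (z : ℝ) :
      ((∏ i, (z - (hH t).eigenvalues₀ i) : ℝ) : ℂ) = (Matrix.scalar n (z : ℂ) - H t).det := by
    rw [← Matrix.eval_charpoly, (hH t).charpoly_eq, Polynomial.eval_prod, Complex.ofReal_prod]
    refine Fintype.prod_equiv (Fintype.equivOfCardEq (Fintype.card_fin _)) _ _ fun i ↦ ?_
    simp [Matrix.IsHermitian.eigenvalues]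
  refine continuous_iff_continuousAt.2 fun t₀ ↦ ?_
  set R := (‖H t₀‖ + 1) * ‖(1 : Matrix n n ℂ)‖
  refine (isCompact_closedBall (0 : Fin (Fintype.card n) → ℝ) R).tendsto_nhds_of_unique_mapClusterPt
    ?_ fun μ _ hμ ↦ ?_
  · have : ∀ᶠ t in 𝓝 t₀, ‖H t‖ < ‖H t₀‖ + 1 :=
      hc.norm.continuousAt.eventually_lt continuousAt_const (lt_add_one _)
    filter_upwards [this] with t ht
    rw [mem_closedBall_zero_iff]
    exact (hH t).norm_eigenvalues₀_le.trans (mul_le_mul_of_nonneg_right ht.le (norm_nonneg _))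
  · refine Antitone.eq_of_forall_prod_sub_eq ?_ (hH t₀).eigenvalues₀_antitone fun z ↦ ?_
    · intro i j hij
      have hcl : IsClosed {ν : Fin (Fintype.card n) → ℝ | ν j ≤ ν i} :=
        isClosed_le (continuous_apply j) (continuous_apply i)
      exact hcl.mem_of_mapClusterPt hμ
        (Eventually.of_forall fun t ↦ (hH t).eigenvalues₀_antitone hij)
    · have hg : Continuous fun ν : Fin (Fintype.card n) → ℝ ↦ ((∏ i, (z - ν i) : ℝ) : ℂ) := by
        fun_prop
      have h₁ := hμ.continuousAt_comp hg.continuousAt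
      have h₂ : Tendsto (fun t ↦ (Matrix.scalar n (z : ℂ) - H t).det) (𝓝 t₀)
          (𝓝 (Matrix.scalar n (z : ℂ) - H t₀).det) :=
        (continuous_const.sub hc).matrix_det.tendsto t₀
      simp only [Function.comp_def, hprod] at h₁
      have h₃ := eq_of_nhds_neBot (NeBot.mono h₁ (inf_le_inf_left _ h₂))
      rw [← hprod] at h₃
      exact_mod_cast h₃

end

/-- The eigenvalues of `A ⊗ 1 - 1 ⊗ A` are the differences of eigenvalues of `A`. -/
theorem Matrix.IsHermitian.charpoly_kronecker_one_sub_one_kronecker {n : Type*} [Fintype n]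
    [DecidableEq n] {A : Matrix n n ℂ} (hA : A.IsHermitian) :
    (A ⊗ₖ (1 : Matrix n n ℂ) - (1 : Matrix n n ℂ) ⊗ₖ A).charpoly
      = ∏ p : n × n, (X - C ((hA.eigenvalues p.1 - hA.eigenvalues p.2 : ℝ) : ℂ)) := by
  set U : Matrix n n ℂ := hA.eigenvectorUnitary.1
  set D : Matrix n n ℂ := Matrix.diagonal (RCLike.ofReal ∘ hA.eigenvalues) with hD
  have hU : U * star U = 1 := Unitary.coe_mul_star_self _
  have hU' : star U * U = 1 := Unitary.coe_star_mul_self _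
  have hAU : A = U * D * star U := by
    conv_lhs => rw [hA.spectral_theorem, Unitary.conjStarAlgAut_apply]
  have key : A ⊗ₖ (1 : Matrix n n ℂ) - (1 : Matrix n n ℂ) ⊗ₖ A
      = (U ⊗ₖ U) * ((D ⊗ₖ (1 : Matrix n n ℂ) - (1 : Matrix n n ℂ) ⊗ₖ D) * (star U ⊗ₖ star U)) := by
    rw [Matrix.sub_mul, Matrix.mul_sub]
    simp only [← Matrix.mul_kronecker_mul, Matrix.one_mul, hU, ← Matrix.mul_assoc, ← hAU]
  rw [key, Matrix.charpoly_mul_comm, Matrix.mul_assoc, ← Matrix.mul_kronecker_mul, hU',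
    Matrix.one_kronecker_one, Matrix.mul_one, hD, ← Matrix.diagonal_one,
    Matrix.diagonal_kronecker_diagonal, Matrix.diagonal_kronecker_diagonal, Matrix.diagonal_sub,
    Matrix.charpoly_diagonal]
  simp

/-- If the number of zeros of a continuous family of finite sequences is constant on a
preconnected set, then so is the set of indices where it vanishes. -/
theorem IsPreconnected.apply_eq_zero_iff_of_card_eq {T ι : Type*} [TopologicalSpace T] [Fintype ι]
    {s : Set T} (hs : IsPreconnected s) {f : T → ι → ℝ} (hf : Continuous f) {k : ℕ}
    (hk : ∀ t ∈ s, (Finset.univ.filter fun i ↦ f t i = 0).card = k)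
    {t₁ t₂ : T} (h₁ : t₁ ∈ s) (h₂ : t₂ ∈ s) (i : ι) : f t₁ i = 0 ↔ f t₂ i = 0 := by
  classical
  let Z : T → Finset ι := fun t ↦ Finset.univ.filter fun i ↦ f t i = 0
  let : TopologicalSpace (Finset ι) := ⊥
  have : DiscreteTopology (Finset ι) := ⟨rfl⟩
  have hZ : ContinuousOn Z s := by
    intro t₀ ht₀
    refine ContinuousWithinAt.congr_of_eventuallyEq
      (continuousWithinAt_const (b := Z t₀)) ?_ rfl
    have hev : ∀ᶠ t in 𝓝 t₀, ∀ i, f t₀ i ≠ 0 → f t i ≠ 0 := by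
      refine eventually_all.2 fun i ↦ ?_
      by_cases hi : f t₀ i = 0
      · simp [hi]
      · filter_upwards [((continuous_apply i).comp hf).continuousAt.eventually_ne hi] with t ht _
        exact ht
    filter_upwards [nhdsWithin_le_nhds hev, self_mem_nhdsWithin] with t ht hts
    refine Finset.eq_of_subset_of_card_le (fun i hi ↦ ?_) ?_
    · simp only [Z, Finset.mem_filter, Finset.mem_univ, true_and] at hi ⊢
      exact not_imp_not.1 (ht i) hi
    · exact ((hk t₀ ht₀).trans (hk t hts).symm).le
  have := hs.constant hZ h₁ h₂
  have h := Finset.ext_iff.1 this i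
  simpa [Z] using h

/-- A continuous real function on a preconnected set which vanishes everywhere or nowhere
keeps its sign. -/
theorem IsPreconnected.pos_of_pos {T : Type*} [TopologicalSpace T]
    {s : Set T} (hs : IsPreconnected s) {g : T → ℝ} (hg : Continuous g)
    (h : ∀ t₁ ∈ s, ∀ t₂ ∈ s, g t₁ = 0 → g t₂ = 0) {t₁ t₂ : T} (h₁ : t₁ ∈ s) (h₂ : t₂ ∈ s)
    (hpos : 0 < g t₁) : 0 < g t₂ := by
  by_contra! hle
  obtain ⟨t, ht, h0⟩ := hs.intermediate_value h₂ h₁ hg.continuousOn ⟨hle, hpos.le⟩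
  exact hpos.ne' (h t ht t₁ h₁ h0)

/-- The multiset of multiplicities of the selected values of a finite family only depends on
which of the values coincide and on which of them are selected. -/
theorem Finset.val_map_card_filter_eq_of_eq_iff {ι α β : Type*} [Fintype ι] [DecidableEq α]
    [DecidableEq β] {f : ι → α} {g : ι → β} (h : ∀ i j, f i = f j ↔ g i = g j) (P : Finset ι) :
    (P.image f).val.map (fun a ↦ (Finset.univ.filter fun i ↦ f i = a).card)
      = (P.image g).val.map (fun b ↦ (Finset.univ.filter fun i ↦ g i = b).card) := by
  classical
  induction P using Finset.induction_on with
  | empty => simp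
  | insert i P _ ih =>
    rw [Finset.image_insert, Finset.image_insert]
    have hmem : f i ∈ P.image f ↔ g i ∈ P.image g := by
      simp [h]
    by_cases hi : f i ∈ P.image f
    · rwa [Finset.insert_eq_of_mem hi, Finset.insert_eq_of_mem (hmem.1 hi)]
    · rw [Finset.insert_val_of_notMem hi, Finset.insert_val_of_notMem (mt hmem.2 hi),
        Multiset.map_cons, Multiset.map_cons, ih]
      simp [h]

theorem Matrix.IsHermitian.positive_roots_charpoly_eq {n : Type*} [Fintype n] [DecidableEq n]
    {A : Matrix n n ℂ} (hA : A.IsHermitian) :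
    (A.charpoly.roots.filter fun z ↦ 0 < z.re)
      = (Finset.univ.filter fun i ↦ 0 < hA.eigenvalues i).val.map
          fun i ↦ (hA.eigenvalues i : ℂ) := by
  rw [hA.roots_charpoly_eq_eigenvalues, Multiset.filter_map]
  simp [Function.comp_def]

theorem Matrix.IsHermitian.rootMultiplicity_charpoly {n : Type*} [Fintype n] [DecidableEq n]
    {A : Matrix n n ℂ} (hA : A.IsHermitian) (z : ℂ) :
    A.charpoly.rootMultiplicity z
      = (Finset.univ.filter fun i ↦ (hA.eigenvalues i : ℂ) = z).card := by
  rw [← Polynomial.count_roots, hA.roots_charpoly_eq_eigenvalues, Multiset.count_map]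
  simp [Finset.card, eq_comm]

/-- Two Hermitian matrices whose eigenvalues coincide and are positive at the same indices have
the same positive eigenvalue structure. -/
theorem Matrix.IsHermitian.positive_structure_eq {n : Type*} [Fintype n] [DecidableEq n]
    {A B : Matrix n n ℂ} (hA : A.IsHermitian) (hB : B.IsHermitian)
    (hpos : ∀ i, 0 < hA.eigenvalues i ↔ 0 < hB.eigenvalues i)
    (heq : ∀ i j, hA.eigenvalues i = hA.eigenvalues j ↔ hB.eigenvalues i = hB.eigenvalues j) :
    ((A.charpoly.roots.filter fun z ↦ 0 < z.re).card
      = (B.charpoly.roots.filter fun z ↦ 0 < z.re).card) ∧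
    ((A.charpoly.roots.filter fun z ↦ 0 < z.re).toFinset.val.map
        fun z ↦ Polynomial.rootMultiplicity z A.charpoly)
      = ((B.charpoly.roots.filter fun z ↦ 0 < z.re).toFinset.val.map
        fun z ↦ Polynomial.rootMultiplicity z B.charpoly) := by
  simp only [hA.positive_roots_charpoly_eq, hB.positive_roots_charpoly_eq,
    hA.rootMultiplicity_charpoly, hB.rootMultiplicity_charpoly, hpos]
  refine ⟨by simp, ?_⟩
  exact Finset.val_map_card_filter_eq_of_eq_iff (by simpa using heq) _

/-- A finite set of reals can be avoided by the pieces of a finite subdivision of `[0, 1]`. -/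
theorem Set.Finite.exists_subdivision {B : Set ℝ} (hB : B.Finite) :
    ∃ (d : ℕ) (s : Fin (d + 1) → ℝ), StrictMono s ∧ s 0 = 0 ∧ s (Fin.last d) = 1 ∧
      ∀ k : Fin d, ∀ t ∈ Set.Ioo (s k.castSucc) (s k.succ), t ∉ B := by
  classical
  set S : Finset ℝ := insert 0 (insert 1 (hB.toFinset.filter fun t ↦ t ∈ Set.Icc (0 : ℝ) 1))
    with hS
  have hS01 : ∀ t ∈ S, 0 ≤ t ∧ t ≤ 1 := by
    intro t ht
    simp only [hS, Finset.mem_insert, Finset.mem_filter, Set.mem_Icc] at ht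
    rcases ht with rfl | rfl | h
    · simp
    · simp
    · exact h.2
  have h0 : (0 : ℝ) ∈ S := by simp [hS]
  have h1 : (1 : ℝ) ∈ S := by simp [hS]
  obtain ⟨d, hd⟩ : ∃ d, S.card = d + 1 :=
    Nat.exists_eq_succ_of_ne_zero (Finset.card_ne_zero_of_mem h0)
  have hrange := S.range_orderEmbOfFin hd
  have hmem (i : Fin (d + 1)) : S.orderEmbOfFin hd i ∈ S := S.orderEmbOfFin_mem hd i
  have hmono := (S.orderEmbOfFin hd).strictMono
  refine ⟨d, S.orderEmbOfFin hd, hmono, ?_, ?_, fun k t ht htB ↦ ?_⟩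
  · obtain ⟨i, hi⟩ : (0 : ℝ) ∈ Set.range (S.orderEmbOfFin hd) := hrange ▸ h0
    exact le_antisymm (hi ▸ hmono.monotone (Fin.zero_le i)) (hS01 _ (hmem _)).1
  · obtain ⟨i, hi⟩ : (1 : ℝ) ∈ Set.range (S.orderEmbOfFin hd) := hrange ▸ h1
    exact le_antisymm (hS01 _ (hmem _)).2 (hi ▸ hmono.monotone (Fin.le_last i))
  · have htS : t ∈ S := by
      simp only [hS, Finset.mem_insert, Finset.mem_filter, Set.Finite.mem_toFinset, Set.mem_Icc]
      exact Or.inr (Or.inr ⟨htB, (hS01 _ (hmem _)).1.trans ht.1.le,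
        ht.2.le.trans (hS01 _ (hmem _)).2⟩)
    obtain ⟨i, rfl⟩ : t ∈ Set.range (S.orderEmbOfFin hd) := hrange ▸ htS
    have h₁ := hmono.lt_iff_lt.1 ht.1
    have h₂ := hmono.lt_iff_lt.1 ht.2
    rw [Fin.lt_def] at h₁ h₂
    simp only [Fin.val_castSucc, Fin.val_succ] at h₁ h₂
    omega

/-- For skew-Hermitian `Xℓ, Xr` and `Y(t) = i((1−t)Xℓ + tXr)`, there is a finite
subdivision `0 = s₀ < s₁ < ⋯ < s_d = 1` of `[0,1]` such that on each open interval
`(s_{k−1}, s_k)` the number of positive eigenvalues of `Y(t)` counted with multiplicity,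
and the multiset of their multiplicities, are constant. -/
theorem constant_positive_eigenvalue_structure
    (n : ℕ) (Xl Xr : Matrix (Fin n) (Fin n) ℂ)
    (hl : Xlᴴ = -Xl) (hr : Xrᴴ = -Xr)
    (Y : ℝ → Matrix (Fin n) (Fin n) ℂ)
    (hY : ∀ t : ℝ, Y t = Complex.I • ((1 - (t : ℂ)) • Xl + (t : ℂ) • Xr)) :
    ∃ (d : ℕ) (s : Fin (d + 1) → ℝ), StrictMono s ∧ s 0 = 0 ∧ s (Fin.last d) = 1 ∧
      ∀ k : Fin d, ∀ t₁ ∈ Set.Ioo (s k.castSucc) (s k.succ),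
        ∀ t₂ ∈ Set.Ioo (s k.castSucc) (s k.succ),
        (((Y t₁).charpoly.roots.filter fun z => 0 < z.re).card
            = ((Y t₂).charpoly.roots.filter fun z => 0 < z.re).card) ∧
        ((((Y t₁).charpoly.roots.filter fun z => 0 < z.re).toFinset.val.map
              fun z => Polynomial.rootMultiplicity z (Y t₁).charpoly)
            = (((Y t₂).charpoly.roots.filter fun z => 0 < z.re).toFinset.val.map
              fun z => Polynomial.rootMultiplicity z (Y t₂).charpoly)) := by
  have hH (t : ℝ) : (Y t).IsHermitian := by
    rw [Matrix.IsHermitian, hY]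
    simp only [Matrix.conjTranspose_smul, Matrix.conjTranspose_add, hl, hr]
    simp
  have hc : Continuous Y := by
    rw [funext hY]
    fun_prop
  have hE : Continuous fun t ↦ (hH t).eigenvalues := by
    refine continuous_pi fun i ↦ ?_
    exact (continuous_apply _).comp (Matrix.IsHermitian.continuous_eigenvalues₀ hc hH)
  let M : Matrix (Fin n) (Fin n) ℂ[X] :=
    C Complex.I • ((1 - X : ℂ[X]) • Xl.map C + (X : ℂ[X]) • Xr.map C)
  have hM (t : ℝ) : M.map (Polynomial.eval (t : ℂ)) = Y t := by
    ext i j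
    simp [M, hY]
    ring
  obtain ⟨B₁, k₁, hB₁, hk₁⟩ := M.exists_finite_rootMultiplicity_zero_charpoly_map_eval
  obtain ⟨B₂, k₂, hB₂, hk₂⟩ := (M ⊗ₖ (1 : Matrix (Fin n) (Fin n) ℂ[X])
    - (1 : Matrix (Fin n) (Fin n) ℂ[X]) ⊗ₖ M).exists_finite_rootMultiplicity_zero_charpoly_map_eval
  have hM₂ (t : ℝ) : (M ⊗ₖ (1 : Matrix (Fin n) (Fin n) ℂ[X])
      - (1 : Matrix (Fin n) (Fin n) ℂ[X]) ⊗ₖ M).map (Polynomial.eval (t : ℂ))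
      = Y t ⊗ₖ (1 : Matrix (Fin n) (Fin n) ℂ) - (1 : Matrix (Fin n) (Fin n) ℂ) ⊗ₖ Y t := by
    ext i j
    simp [← hM, Matrix.one_apply, apply_ite (Polynomial.eval (t : ℂ))]
  obtain ⟨d, s, hs, hs0, hs1, hB⟩ := Set.Finite.exists_subdivision
    (((hB₁.union hB₂).preimage Complex.ofReal_injective.injOn))
  refine ⟨d, s, hs, hs0, hs1, fun k t₁ h₁ t₂ h₂ ↦ ?_⟩
  have hI : IsPreconnected (Set.Ioo (s k.castSucc) (s k.succ)) := isPreconnected_Ioo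
  have hzero {t₁ t₂ : ℝ} (h₁ : t₁ ∈ Set.Ioo (s k.castSucc) (s k.succ))
      (h₂ : t₂ ∈ Set.Ioo (s k.castSucc) (s k.succ)) (i : Fin n) :
      (hH t₁).eigenvalues i = 0 ↔ (hH t₂).eigenvalues i = 0 := by
    refine hI.apply_eq_zero_iff_of_card_eq hE (k := k₁) (fun t ht ↦ ?_) h₁ h₂ i
    rw [← hk₁ t fun h ↦ hB k t ht (Or.inl h), hM, (hH t).rootMultiplicity_charpoly]
    simp
  have hdiff (p : Fin n × Fin n) :
      (hH t₁).eigenvalues p.1 - (hH t₁).eigenvalues p.2 = 0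
        ↔ (hH t₂).eigenvalues p.1 - (hH t₂).eigenvalues p.2 = 0 := by
    refine hI.apply_eq_zero_iff_of_card_eq (k := k₂)
      (f := fun t p ↦ (hH t).eigenvalues p.1 - (hH t).eigenvalues p.2) ?_ (fun t ht ↦ ?_) h₁ h₂ p
    · exact continuous_pi fun p ↦
        ((continuous_apply p.1).comp hE).sub ((continuous_apply p.2).comp hE)
    · rw [← hk₂ t fun h ↦ hB k t ht (Or.inr h), hM₂,
        (hH t).charpoly_kronecker_one_sub_one_kronecker,
        Polynomial.rootMultiplicity_zero_prod_X_sub_C]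
      simp only [Complex.ofReal_eq_zero]
  have hsign {t₁ t₂ : ℝ} (h₁ : t₁ ∈ Set.Ioo (s k.castSucc) (s k.succ))
      (h₂ : t₂ ∈ Set.Ioo (s k.castSucc) (s k.succ)) (i : Fin n) :
      0 < (hH t₁).eigenvalues i → 0 < (hH t₂).eigenvalues i :=
    hI.pos_of_pos ((continuous_apply i).comp hE) (fun _ h _ h' ↦ (hzero h h' i).1) h₁ h₂
  exact (hH t₁).positive_structure_eq (hH t₂) (fun i ↦ ⟨hsign h₁ h₂ i, hsign h₂ h₁ i⟩)
    fun i j ↦ by simpa only [sub_eq_zero] using hdiff (i, j)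
end

section
/- Let α, β : [0,1] → Mₙ(ℂ) be continuous and let k : [0,1] → U(n) be continuously differentiable with values in the unitary group U(n) = {g ∈ Mₙ(ℂ) : g·g* = I}. Define the gauge transform α'(t) = k(t)·α(t)·k(t)⁻¹ − k'(t)·k(t)⁻¹ and β'(t) = k(t)·β(t)·k(t)⁻¹. Then ∫₀¹ ( ‖Im(α'(t))‖² + (1/2)·‖β'(t)‖² ) dt = ∫₀¹ ( ‖Im(α(t))‖² + (1/2)·‖β(t)‖² ) dt, where the norm is the Frobenius norm. In particular, the Kähler potential formula ∫₀¹ |Im(α)|² + (1/2)|β|² is invariant under gauge transformations valued in the maximal compact subgroup U(n). -/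
open scoped Matrix

attribute [local instance] Matrix.frobeniusNormedAddCommGroup Matrix.frobeniusNormedSpace

/-- The squared Frobenius norm `‖A‖² = Tr(A·A*)` of a complex matrix. -/
noncomputable def frobSq {n : ℕ} (A : Matrix (Fin n) (Fin n) ℂ) : ℝ :=
  (Matrix.trace (A * Aᴴ)).re

/-- The "imaginary part" `Im(A) = (A + A*)/(2i)` of a complex matrix. -/
noncomputable def matIm {n : ℕ} (A : Matrix (Fin n) (Fin n) ℂ) : Matrix (Fin n) (Fin n) ℂ :=
  (2 * Complex.I)⁻¹ • (A + Aᴴ)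

theorem frobSq_unitary_conj {n : ℕ} {U : Matrix (Fin n) (Fin n) ℂ} (hU : U * Uᴴ = 1)
    (A : Matrix (Fin n) (Fin n) ℂ) : frobSq (U * A * Uᴴ) = frobSq A := by
  have hU' : Uᴴ * U = 1 := mul_eq_one_comm.mp hU
  have h : U * A * Uᴴ * (U * A * Uᴴ)ᴴ = U * (A * Aᴴ) * Uᴴ := by
    simp only [Matrix.conjTranspose_mul, Matrix.conjTranspose_conjTranspose, Matrix.mul_assoc]
    rw [← Matrix.mul_assoc Uᴴ U, hU', Matrix.one_mul]
  rw [frobSq, h, Matrix.trace_mul_comm, ← Matrix.mul_assoc, hU', Matrix.one_mul, frobSq]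

theorem matIm_conj_sub {n : ℕ} {B : Matrix (Fin n) (Fin n) ℂ} (hB : B + Bᴴ = 0)
    (U A : Matrix (Fin n) (Fin n) ℂ) : matIm (U * A * Uᴴ - B) = U * matIm A * Uᴴ := by
  have h : U * A * Uᴴ - B + (U * A * Uᴴ - B)ᴴ = U * (A + Aᴴ) * Uᴴ := by
    simp only [Matrix.conjTranspose_sub, Matrix.conjTranspose_mul,
      Matrix.conjTranspose_conjTranspose, Matrix.mul_add, Matrix.add_mul, Matrix.mul_assoc]
    rw [eq_neg_of_add_eq_zero_right hB]
    abel
  rw [matIm, h, matIm, Matrix.mul_smul, Matrix.smul_mul]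

section

attribute [local instance] Matrix.frobeniusNormedRing Matrix.frobeniusNormedAlgebra

theorem hasDerivAt_mul_conjTranspose {n : ℕ} {k : ℝ → Matrix (Fin n) (Fin n) ℂ}
    {k' : Matrix (Fin n) (Fin n) ℂ} {t : ℝ} (hk : HasDerivAt k k' t) :
    HasDerivAt (fun s => k s * (k s)ᴴ) (k' * (k t)ᴴ + k t * k'ᴴ) t :=
  hk.mul hk.star

end

/-- The logarithmic derivative of a path of unitary matrices is skew-Hermitian. -/
theorem deriv_mul_conjTranspose_add_eq_zero {n : ℕ} {k : ℝ → Matrix (Fin n) (Fin n) ℂ} {t : ℝ}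
    (hk : DifferentiableAt ℝ k t) (hku : ∀ᶠ s in nhds t, k s * (k s)ᴴ = 1) :
    deriv k t * (k t)ᴴ + (deriv k t * (k t)ᴴ)ᴴ = 0 := by
  rw [Matrix.conjTranspose_mul, Matrix.conjTranspose_conjTranspose]
  exact (hasDerivAt_mul_conjTranspose hk.hasDerivAt).unique
    ((hasDerivAt_const t (1 : Matrix (Fin n) (Fin n) ℂ)).congr_of_eventuallyEq hku)

/-- The Kähler potential formula `∫₀¹ ‖Im α‖² + ½‖β‖²` (Frobenius norms) is invariant
under gauge transformations `α ↦ kαk⁻¹ − k'k⁻¹`, `β ↦ kβk⁻¹` by a continuously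
differentiable path `k` in the unitary group `U(n)`. -/
theorem kahler_potential_gauge_invariance
    (n : ℕ) (α β : ℝ → Matrix (Fin n) (Fin n) ℂ)
    (hα : ContinuousOn α (Set.Icc 0 1)) (hβ : ContinuousOn β (Set.Icc 0 1))
    (k : ℝ → Matrix (Fin n) (Fin n) ℂ)
    (hk : ContDiff ℝ 1 k)
    (hku : ∀ t ∈ Set.Icc (0 : ℝ) 1, k t * (k t)ᴴ = 1) :
    (∫ t in (0 : ℝ)..1,
        (frobSq (matIm (k t * α t * (k t)⁻¹ - deriv k t * (k t)⁻¹))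
          + (1 / 2) * frobSq (k t * β t * (k t)⁻¹)))
      = ∫ t in (0 : ℝ)..1, (frobSq (matIm (α t)) + (1 / 2) * frobSq (β t)) := by
  simp only [intervalIntegral.integral_of_le zero_le_one,
    MeasureTheory.integral_Ioc_eq_integral_Ioo]
  refine MeasureTheory.setIntegral_congr_fun measurableSet_Ioo fun t ht => ?_
  have hU := hku t (Set.Ioo_subset_Icc_self ht)
  have hskew := deriv_mul_conjTranspose_add_eq_zero (hk.differentiable one_ne_zero t)
    (Filter.eventually_of_mem (Icc_mem_nhds ht.1 ht.2) hku)
  simp only [Matrix.inv_eq_right_inv hU, matIm_conj_sub hskew, frobSq_unitary_conj hU]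
end
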